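/- Let 2 ≤ m ≤ p, let R ∈ ℝ^{p×m} be a sampling matrix whose m columns are chosen uniformly at random from the set of p canonical basis vectors of ℝ^p without replacement, and let x ∈ ℝ^p be a fixed vector. Then E[ ( (p/m)·R Rᵀ x − x )·( (p/m)·R Rᵀ x − x )ᵀ ] = −((p−m)/(m(p−1)))·x xᵀ + (p(p−m)/(m(p−1)))·diag(x xᵀ). -/

import Mathlib

open Matrix Finset

/-- Probability of event `A` under the uniform distribution on the finite type `Ω`. -/
noncomputable def probOf {Ω : Type*} [Fintype Ω] (A : Set Ω) : ℝ :=
  (A.ncard : ℝ) / Fintype.card Ω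

/-- Expectation of `f` under the uniform distribution on the finite type `Ω`. -/
noncomputable def expec {Ω E : Type*} [Fintype Ω] [AddCommMonoid E] [Module ℝ E]
    (f : Ω → E) : E :=
  (Fintype.card Ω : ℝ)⁻¹ • ∑ ω, f ω

/-- Euclidean norm of a vector. -/
noncomputable def l2norm {ι : Type*} [Fintype ι] (v : ι → ℝ) : ℝ :=
  Real.sqrt (∑ i, v i ^ 2)

/-- Random sign vector `ε ∈ {±1}^p` built from boolean coin flips. -/
def signVec {p : ℕ} (ω : Fin p → Bool) : Fin p → ℝ := fun i => if ω i then 1 else -1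

/-- The diagonal random sign matrix `D = diag(ε)`. -/
noncomputable def signMatrix {p : ℕ} (ω : Fin p → Bool) : Matrix (Fin p) (Fin p) ℝ :=
  Matrix.diagonal (signVec ω)

/-- Sampling matrix `R ∈ ℝ^{p×m}` whose `j`-th column is the canonical basis vector `e_{σ j}`;
a uniformly random `σ : Fin m ↪ Fin p` models choosing `m` distinct canonical basis vectors
uniformly at random without replacement. -/
noncomputable def sampMatrix {p m : ℕ} (σ : Fin m ↪ Fin p) : Matrix (Fin p) (Fin m) ℝ :=
  Matrix.of fun i j => if σ j = i then 1 else 0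

/-- Spectral norm (ℓ²→ℓ² operator norm) of a square matrix. -/
noncomputable def specNorm {p : ℕ} (A : Matrix (Fin p) (Fin p) ℝ) : ℝ :=
  ‖LinearMap.toContinuousLinearMap (Matrix.toEuclideanLin A)‖

/-- `diag(A)`: the matrix obtained by zeroing all off-diagonal entries of `A`. -/
noncomputable def diagPart {p : ℕ} (A : Matrix (Fin p) (Fin p) ℝ) : Matrix (Fin p) (Fin p) ℝ :=
  Matrix.diagonal A.diag

/-- Indicator that coordinate `i` is sampled. -/
noncomputable def sInd {p m : ℕ} (i : Fin p) (σ : Fin m ↪ Fin p) : ℝ :=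
  ∑ j, if σ j = i then 1 else 0

theorem sInd_mulVec {p m : ℕ} (σ : Fin m ↪ Fin p) (x : Fin p → ℝ) (i : Fin p) :
    ((sampMatrix σ * (sampMatrix σ)ᵀ) *ᵥ x) i = sInd i σ * x i := by
  rw [← Matrix.mulVec_mulVec]
  simp only [Matrix.mulVec, dotProduct, sampMatrix, Matrix.of_apply, Matrix.transpose_apply, sInd,
    Finset.sum_mul]
  refine Finset.sum_congr rfl fun j _ => ?_
  by_cases h : σ j = i <;> simp [h]

theorem sInd_sum {p m : ℕ} (σ : Fin m ↪ Fin p) : ∑ i, sInd i σ = m := by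
  unfold sInd
  rw [Finset.sum_comm]
  simp

theorem sInd_sq {p m : ℕ} (σ : Fin m ↪ Fin p) (i : Fin p) :
    sInd i σ * sInd i σ = sInd i σ := by
  unfold sInd
  rw [Finset.sum_mul]
  refine Finset.sum_congr rfl fun j _ => ?_
  by_cases h : σ j = i
  · subst h
    simp
  · simp [h]

theorem sInd_trans {p m : ℕ} (σ : Fin m ↪ Fin p) (e : Equiv.Perm (Fin p)) (i : Fin p) :
    sInd (e i) (σ.trans e.toEmbedding) = sInd i σ := by
  simp [sInd]

theorem sum_perm {p m : ℕ} (e : Equiv.Perm (Fin p)) (f : (Fin m ↪ Fin p) → ℝ) :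
    ∑ σ : Fin m ↪ Fin p, f (σ.trans e.toEmbedding) = ∑ σ, f σ := by
  exact Equiv.sum_comp (Equiv.embeddingCongr (Equiv.refl (Fin m)) e) f

theorem first_moment {p m : ℕ} (i : Fin p) :
    (p : ℝ) * ∑ σ : Fin m ↪ Fin p, sInd i σ = m * Fintype.card (Fin m ↪ Fin p) := by
  have h : ∀ k : Fin p, ∑ σ : Fin m ↪ Fin p, sInd k σ = ∑ σ : Fin m ↪ Fin p, sInd i σ := by
    intro k
    rw [← sum_perm (Equiv.swap i k) (sInd k)]
    refine Finset.sum_congr rfl fun σ _ => ?_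
    have := sInd_trans σ (Equiv.swap i k) i
    rwa [Equiv.swap_apply_left] at this
  have h2 : ∑ k : Fin p, ∑ σ : Fin m ↪ Fin p, sInd k σ = p * ∑ σ : Fin m ↪ Fin p, sInd i σ := by
    rw [Finset.sum_congr rfl fun k _ => h k]
    simp
  rw [← h2, Finset.sum_comm]
  simp only [sInd_sum]
  simp [mul_comm]

theorem second_moment {p m : ℕ} (i k : Fin p) (hik : i ≠ k) :
    ((p : ℝ) - 1) * ∑ σ : Fin m ↪ Fin p, sInd i σ * sInd k σ =
      (m - 1) * ∑ σ : Fin m ↪ Fin p, sInd i σ := by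
  have h : ∀ l ∈ (Finset.univ : Finset (Fin p)).erase i,
      ∑ σ : Fin m ↪ Fin p, sInd i σ * sInd l σ = ∑ σ : Fin m ↪ Fin p, sInd i σ * sInd k σ := by
    intro l hl
    have hl : l ≠ i := Finset.ne_of_mem_erase hl
    rw [← sum_perm (Equiv.swap k l) (fun σ => sInd i σ * sInd l σ)]
    refine Finset.sum_congr rfl fun σ _ => ?_
    have h1 := sInd_trans σ (Equiv.swap k l) k
    have h2 := sInd_trans σ (Equiv.swap k l) i
    rw [Equiv.swap_apply_left] at h1
    rw [Equiv.swap_apply_of_ne_of_ne hik hl.symm] at h2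
    rw [h1, h2]
  have h2 : ∑ l : Fin p, ∑ σ : Fin m ↪ Fin p, sInd i σ * sInd l σ =
      m * ∑ σ : Fin m ↪ Fin p, sInd i σ := by
    rw [Finset.sum_comm]
    simp only [← Finset.mul_sum, sInd_sum]
    rw [← Finset.sum_mul, mul_comm]
  rw [← Finset.add_sum_erase _ _ (Finset.mem_univ i), Finset.sum_congr rfl h] at h2
  simp only [sInd_sq] at h2
  rw [Finset.sum_const, Finset.card_erase_of_mem (Finset.mem_univ i), nsmul_eq_mul,
    Finset.card_univ, Fintype.card_fin, Nat.cast_sub (Fin.pos i)] at h2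
  push_cast at h2
  linarith

/-- `E[((p/m)·R Rᵀ x − x)·((p/m)·R Rᵀ x − x)ᵀ]
= −((p−m)/(m(p−1)))·x xᵀ + (p(p−m)/(m(p−1)))·diag(x xᵀ)`. -/
theorem stmt_18 (p m : ℕ) (hm : 2 ≤ m) (hmp : m ≤ p) (x : Fin p → ℝ) :
    expec (fun σ : Fin m ↪ Fin p =>
        Matrix.vecMulVec (((p : ℝ) / m) • ((sampMatrix σ * (sampMatrix σ)ᵀ) *ᵥ x) - x)
          (((p : ℝ) / m) • ((sampMatrix σ * (sampMatrix σ)ᵀ) *ᵥ x) - x)) =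
      (-(((p : ℝ) - m) / ((m : ℝ) * ((p : ℝ) - 1)))) • Matrix.vecMulVec x x +
        (((p : ℝ) * ((p : ℝ) - m)) / ((m : ℝ) * ((p : ℝ) - 1))) •
          diagPart (Matrix.vecMulVec x x) := by
  have hp1 : (p : ℝ) - 1 ≠ 0 := by
    have : (2 : ℝ) ≤ p := by exact_mod_cast hm.trans hmp
    intro h
    linarith
  have hp0 : (p : ℝ) ≠ 0 := by
    have : p ≠ 0 := by omega
    exact_mod_cast this
  have hm0 : (m : ℝ) ≠ 0 := by
    have : m ≠ 0 := by omega
    exact_mod_cast this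
  have hN : (Fintype.card (Fin m ↪ Fin p) : ℝ) ≠ 0 := by
    have : Nonempty (Fin m ↪ Fin p) := ⟨Fin.castLEEmb hmp⟩
    exact_mod_cast Fintype.card_ne_zero
  ext i k
  have hS : ∀ i : Fin p, ∑ σ : Fin m ↪ Fin p, sInd i σ =
      m * Fintype.card (Fin m ↪ Fin p) / p := by
    intro i
    rw [eq_div_iff hp0, ← first_moment i, mul_comm]
  have key : ∑ σ : Fin m ↪ Fin p,
      (((p : ℝ) / m) * (sInd i σ * x i) - x i) * (((p : ℝ) / m) * (sInd k σ * x k) - x k) =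
      ((p : ℝ) / m) ^ 2 * x i * x k * (∑ σ : Fin m ↪ Fin p, sInd i σ * sInd k σ)
        - (p : ℝ) / m * x i * x k * (∑ σ : Fin m ↪ Fin p, sInd i σ)
        - (p : ℝ) / m * x i * x k * (∑ σ : Fin m ↪ Fin p, sInd k σ)
        + Fintype.card (Fin m ↪ Fin p) * (x i * x k) := by
    rw [Finset.mul_sum, Finset.mul_sum, Finset.mul_sum, ← Finset.sum_sub_distrib,
      ← Finset.sum_sub_distrib, ← nsmul_eq_mul, ← Finset.card_univ, ← Finset.sum_const,
      ← Finset.sum_add_distrib]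
    refine Finset.sum_congr rfl fun σ _ => ?_
    ring
  simp only [expec, Matrix.smul_apply, Matrix.sum_apply, Matrix.add_apply, Matrix.vecMulVec_apply,
    Pi.sub_apply, Pi.smul_apply, sInd_mulVec, smul_eq_mul, diagPart]
  rw [key, hS, hS]
  generalize (Fintype.card (Fin m ↪ Fin p) : ℝ) = N at *
  by_cases hik : i = k
  · subst hik
    simp only [sInd_sq, hS, Matrix.diagonal_apply_eq, Matrix.diag_apply, Matrix.vecMulVec_apply]
    field_simp
    ring
  · have h2 := second_moment (m := m) i k hik
    rw [hS, mul_comm, ← eq_div_iff hp1] at h2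
    rw [h2, Matrix.diagonal_apply_ne _ hik]
    field_simp
    ring
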